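/- Suppose that for some n ≥ 1 the simple Markov chain X satisfies: there exists a constant δ > 0 such that P^n(i,i) ≥ δ for all but finitely many states i ∈ S, and moreover X^(n) is simple. Then X is asymptotically aperiodic. -/

import Mathlib

open MeasureTheory Filter Set ProbabilityTheory

/-- A discrete-time Markov chain on a state space `S`: a stochastic transition
matrix `P`, an initial distribution `init`, and the induced probability measure
`μ` on the path space `ℕ → S`, determined by its values on cylinder sets. -/
structure MarkovChain (S : Type) [MeasurableSpace S] where
  P : S → S → ℝ
  P_nonneg : ∀ i j, 0 ≤ P i j
  P_stochastic : ∀ i, HasSum (P i) 1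
  init : S → ℝ
  init_nonneg : ∀ i, 0 ≤ init i
  init_hasSum : HasSum init 1
  μ : Measure (ℕ → S)
  μ_prob : IsProbabilityMeasure μ
  μ_cylinder : ∀ (n : ℕ) (s : ℕ → S),
    μ {ω | ∀ k ≤ n, ω k = s k}
      = ENNReal.ofReal (init (s 0) * ∏ k ∈ Finset.range n, P (s k) (s (k + 1)))

namespace MarkovChain

variable {S : Type} [MeasurableSpace S]

open Classical in
/-- The `n`-step transition probabilities `P^n(i,j)`. -/
noncomputable def Pn (X : MarkovChain S) : ℕ → S → S → ℝ
  | 0, i, j => if i = j then 1 else 0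
  | n + 1, i, j => ∑' k : S, X.Pn n i k * X.P k j

/-- Irreducibility: every state can be reached from every state. -/
def Irreducible (X : MarkovChain S) : Prop := ∀ i j : S, ∃ n : ℕ, 0 < X.Pn n i j

/-- Aperiodicity: for each state, the gcd of the set `{n ≥ 1 | P^n(i,i) > 0}`
is `1` (expressed via common divisors). -/
def Aperiodic (X : MarkovChain S) : Prop :=
  ∀ i : S, ∀ d : ℕ, (∀ n : ℕ, 0 < n → 0 < X.Pn n i i → d ∣ n) → d = 1

/-- `U^(m)(C)`: the event that the `m`-step chain visits `C` infinitely often. -/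
def U (X : MarkovChain S) (m : ℕ) (C : Set S) : Set (ℕ → S) :=
  {ω | ∀ n : ℕ, ∃ k : ℕ, n ≤ k ∧ ω (k * m) ∈ C}

/-- `L^(m)(C)`: the event that the `m`-step chain is eventually in `C`. -/
def L (X : MarkovChain S) (m : ℕ) (C : Set S) : Set (ℕ → S) :=
  {ω | ∃ n : ℕ, ∀ k : ℕ, n ≤ k → ω (k * m) ∈ C}

/-- `C` is transient with respect to the `m`-step chain `X^(m)`. -/
def Transient (X : MarkovChain S) (m : ℕ) (C : Set S) : Prop := X.μ (X.U m C) = 0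

/-- `C` is regular with respect to `X^(m)`: `U^(m)(C)` and `L^(m)(C)` agree up
to a null event. -/
def Regular (X : MarkovChain S) (m : ℕ) (C : Set S) : Prop :=
  X.μ (symmDiff (X.U m C) (X.L m C)) = 0

/-- `C` is almost closed with respect to `X^(m)`: regular but not transient. -/
def AlmostClosed (X : MarkovChain S) (m : ℕ) (C : Set S) : Prop :=
  X.Regular m C ∧ ¬ X.Transient m C

/-- An almost closed set is atomic if it does not contain two disjoint almost
closed subsets. -/
def Atomic (X : MarkovChain S) (m : ℕ) (C : Set S) : Prop :=
  X.AlmostClosed m C ∧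
    ¬ ∃ A B : Set S, A ⊆ C ∧ B ⊆ C ∧ Disjoint A B ∧
      X.AlmostClosed m A ∧ X.AlmostClosed m B

/-- A Blackwell decomposition for the `m`-step chain `X^(m)`: a countable
collection of pairwise disjoint almost closed sets, all atomic except at most
one, where a nonatomic member contains no atomic subsets and consists of
transient states, and such that the probabilities `μ(L^(m)(C))` sum to one. -/
structure IsBlackwell (X : MarkovChain S) (m : ℕ) (𝒞 : Set (Set S)) : Prop where
  countable : 𝒞.Countable
  almostClosed : ∀ C ∈ 𝒞, X.AlmostClosed m C
  disjoint : 𝒞.PairwiseDisjoint id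
  atMostOneNonatomic : ∀ C₁ ∈ 𝒞, ∀ C₂ ∈ 𝒞, ¬ X.Atomic m C₁ → ¬ X.Atomic m C₂ → C₁ = C₂
  nonatomicNoAtomicSubset : ∀ C ∈ 𝒞, ¬ X.Atomic m C → ∀ A : Set S, A ⊆ C → ¬ X.Atomic m A
  nonatomicTransientStates : ∀ C ∈ 𝒞, ¬ X.Atomic m C → ∀ i ∈ C, X.Transient m {i}
  sum_L_eq_one : ∑' C : 𝒞, X.μ (X.L m (C : Set S)) = 1

/-- `β(X^(m))`: the number of sets in a Blackwell decomposition for `X^(m)`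
(well defined since the decomposition is unique up to equivalence). -/
noncomputable def beta (X : MarkovChain S) (m : ℕ) : ℕ∞ :=
  sInf (Set.encard '' {𝒞 : Set (Set S) | X.IsBlackwell m 𝒞})

/-- `X` is simple if `β(X) = 1`. -/
def Simple (X : MarkovChain S) : Prop := X.beta 1 = 1

/-- The asymptotic period `d(X) = sup {m ≥ 1 | β(X^(m)) = m}` (possibly `∞`). -/
noncomputable def period (X : MarkovChain S) : ℕ∞ :=
  sSup {d : ℕ∞ | ∃ m : ℕ, 1 ≤ m ∧ X.beta m = (m : ℕ∞) ∧ d = (m : ℕ∞)}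

/-- Recurrence: every state is visited infinitely often almost surely. -/
def Recurrent (X : MarkovChain S) : Prop := ∀ i : S, X.μ (X.U 1 {i}) = 1

end MarkovChain

/-- The shift operator `θ` on path space: `(θ ω)(n) = ω(n+1)`. -/
def pathShift {S : Type} : (ℕ → S) → ℕ → S := fun ω n => ω (n + 1)

/-- An event `E` is `m`-invariant if its indicator function `f` satisfies
`f(ω) = f(θ^m ω)` for all paths `ω`. -/
def MInvariant {S : Type} (m : ℕ) (E : Set (ℕ → S)) : Prop :=
  ∀ ω : ℕ → S, ω ∈ E ↔ pathShift^[m] ω ∈ E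

/-- A birth-death process: a Markov chain on `ℕ` with positive birth
probabilities `p_i = P(i,i+1)`, positive death probabilities `q_{i+1} = P(i+1,i)`,
all transition probabilities other than `p_i`, `q_i` and `r_i = P(i,i)` zero,
and at least one positive self-transition probability. -/
structure MarkovChain.IsBirthDeath (X : MarkovChain ℕ) : Prop where
  birth_pos : ∀ i : ℕ, 0 < X.P i (i + 1)
  death_pos : ∀ i : ℕ, 0 < X.P (i + 1) i
  tridiagonal : ∀ i j : ℕ, 1 < |(i : ℤ) - (j : ℤ)| → X.P i j = 0
  self_pos : ∃ i : ℕ, 0 < X.P i i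

namespace MarkovChain

section

variable {S : Type} [MeasurableSpace S]

open scoped ENNReal

instance (X : MarkovChain S) : IsProbabilityMeasure X.μ := X.μ_prob

lemma Pn_nonneg (X : MarkovChain S) (n : ℕ) (i j : S) : 0 ≤ X.Pn n i j := by
  induction n generalizing j with
  | zero => simp only [Pn]; split_ifs <;> norm_num
  | succ n ih => exact tsum_nonneg fun k => mul_nonneg (ih k) (X.P_nonneg k j)

lemma P_le_one (X : MarkovChain S) (i j : S) : X.P i j ≤ 1 :=
  le_hasSum (X.P_stochastic i) j fun k _ => X.P_nonneg i k

lemma tsum_ofReal_P (X : MarkovChain S) (i : S) : ∑' j, ENNReal.ofReal (X.P i j) = 1 := by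
  rw [← ENNReal.ofReal_tsum_of_nonneg (X.P_nonneg i) (X.P_stochastic i).summable,
    (X.P_stochastic i).tsum_eq, ENNReal.ofReal_one]

lemma summable_Pn_mul {X : MarkovChain S} {n : ℕ} {i : S} (h : Summable (X.Pn n i)) (j : S) :
    Summable fun k => X.Pn n i k * X.P k j :=
  h.of_nonneg_of_le (fun k => mul_nonneg (X.Pn_nonneg n i k) (X.P_nonneg k j))
    fun k => mul_le_of_le_one_right (X.Pn_nonneg n i k) (X.P_le_one k j)

lemma ofReal_Pn_succ {X : MarkovChain S} {n : ℕ} {i : S} (h : Summable (X.Pn n i)) (j : S) :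
    ENNReal.ofReal (X.Pn (n + 1) i j)
      = ∑' k, ENNReal.ofReal (X.Pn n i k) * ENNReal.ofReal (X.P k j) := by
  rw [Pn, ENNReal.ofReal_tsum_of_nonneg
    (fun k => mul_nonneg (X.Pn_nonneg n i k) (X.P_nonneg k j)) (summable_Pn_mul h j)]
  simp_rw [ENNReal.ofReal_mul (X.Pn_nonneg n i _)]

lemma summable_Pn_and_tsum (X : MarkovChain S) (n : ℕ) (i : S) :
    Summable (X.Pn n i) ∧ ∑' j, ENNReal.ofReal (X.Pn n i j) = 1 := by
  classical
  induction n with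
  | zero =>
    have h : X.Pn 0 i = fun j => if j = i then 1 else 0 := by
      funext j; simp [Pn, eq_comm]
    refine ⟨h ▸ (hasSum_ite_eq i (1 : ℝ)).summable, ?_⟩
    rw [h, tsum_eq_single i fun j hj => by simp [hj]]
    simp
  | succ n ih =>
    have h1 : ∑' j, ENNReal.ofReal (X.Pn (n + 1) i j) = 1 := by
      simp_rw [ofReal_Pn_succ ih.1]
      rw [ENNReal.tsum_comm]
      simp_rw [ENNReal.tsum_mul_left, tsum_ofReal_P, mul_one]
      exact ih.2
    refine ⟨?_, h1⟩
    have h2 := ENNReal.summable_toReal (h1.trans_ne ENNReal.one_ne_top)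
    simpa [ENNReal.toReal_ofReal (X.Pn_nonneg _ _ _)] using h2

lemma summable_Pn (X : MarkovChain S) (n : ℕ) (i : S) : Summable (X.Pn n i) :=
  (X.summable_Pn_and_tsum n i).1

lemma tsum_ofReal_Pn (X : MarkovChain S) (n : ℕ) (i : S) :
    ∑' j, ENNReal.ofReal (X.Pn n i j) = 1 :=
  (X.summable_Pn_and_tsum n i).2

lemma Pn_mul_Pn_le (X : MarkovChain S) (a b : ℕ) (i j k : S) :
    X.Pn a i j * X.Pn b j k ≤ X.Pn (a + b) i k := by
  induction b generalizing k with
  | zero =>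
    simp only [Pn, add_zero]
    split_ifs with h
    · simp [h]
    · simpa using X.Pn_nonneg a i k
  | succ b ih =>
    rw [← add_assoc, Pn, Pn, ← tsum_mul_left]
    refine Summable.tsum_le_tsum (fun z => ?_) ((summable_Pn_mul (X.summable_Pn b j) k).mul_left _)
      (summable_Pn_mul (X.summable_Pn (a + b) i) k)
    rw [← mul_assoc]
    exact mul_le_mul_of_nonneg_right (ih z) (X.P_nonneg z k)

lemma eventually_Pn_self_pos {X : MarkovChain S} (hap : X.Aperiodic) (i : S) :
    ∀ᶠ n in atTop, 0 < X.Pn n i i := by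
  let s : AddSubmonoid ℕ :=
    { carrier := {n | 0 < X.Pn n i i}
      zero_mem' := by simp [Pn]
      add_mem' := fun {a b} ha hb => (mul_pos ha hb).trans_le (X.Pn_mul_Pn_le a b i i i) }
  obtain ⟨N, hN⟩ := Nat.exists_mem_closure_of_ge (s : Set ℕ)
  have hgcd : Nat.setGcd (s : Set ℕ) = 1 :=
    hap i _ fun n _ hn => Nat.setGcd_dvd_of_mem hn
  filter_upwards [eventually_ge_atTop N] with n hn
  have := hN n hn (by rw [hgcd]; exact one_dvd n)
  rw [AddSubmonoid.closure_eq] at this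
  exact this

lemma eventually_Pn_pos {X : MarkovChain S} (hirr : X.Irreducible) (hap : X.Aperiodic) (i j : S) :
    ∀ᶠ n in atTop, 0 < X.Pn n i j := by
  obtain ⟨a, ha⟩ := hirr i j
  obtain ⟨N, hN⟩ := eventually_atTop.1 (eventually_Pn_self_pos hap j)
  filter_upwards [eventually_ge_atTop (a + N)] with n hn
  have h := X.Pn_mul_Pn_le a (n - a) i j j
  rw [Nat.add_sub_cancel' (by omega)] at h
  exact (mul_pos ha (hN _ (by omega))).trans_le h

variable [MeasurableSingletonClass S] [Countable S]

lemma measurableSet_coord (t : ℕ) (Q : Set S) : MeasurableSet {ω : ℕ → S | ω t ∈ Q} :=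
  measurable_pi_apply t (Q.to_countable.measurableSet)

/-- The Markov property over one step, for an event of the past. -/
lemma measure_step (X : MarkovChain S) {t : ℕ} {H : Set (ℕ → S)}
    (hH : MeasurableSet[Filtration.piLE (X := fun _ : ℕ => S) t] H) (x y : S) :
    X.μ (H ∩ {ω | ω t = x} ∩ {ω | ω (t + 1) = y})
      = X.μ (H ∩ {ω | ω t = x}) * ENNReal.ofReal (X.P x y) := by
  obtain ⟨B, hB, rfl⟩ := hH
  have hm : ∀ t (x : S), MeasurableSet {ω : ℕ → S | ω t = x} := fun t x =>
    measurableSet_coord t {x}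
  have hr := Preorder.measurable_restrictLe (X := fun _ : ℕ => S) t
  have key : (X.μ.restrict ({ω | ω t = x} ∩ {ω | ω (t + 1) = y})).map (Preorder.restrictLe t)
      = ENNReal.ofReal (X.P x y) •
        (X.μ.restrict {ω | ω t = x}).map (Preorder.restrictLe t) := by
    refine Measure.ext_of_singleton fun w => ?_
    have hw : MeasurableSet (Preorder.restrictLe (π := fun _ : ℕ => S) t ⁻¹' {w}) :=
      hr (measurableSet_singleton w)
    rw [Measure.smul_apply, Measure.map_apply hr (measurableSet_singleton w),
      Measure.map_apply hr (measurableSet_singleton w), Measure.restrict_apply hw,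
      Measure.restrict_apply hw]
    by_cases hx : w ⟨t, le_refl t⟩ = x
    · let s : ℕ → S := fun k => if h : k ≤ t then w ⟨k, h⟩ else y
      have e1 : Preorder.restrictLe (π := fun _ : ℕ => S) t ⁻¹' {w} ∩ {ω | ω t = x}
          = {ω | ∀ k ≤ t, ω k = s k} := by
        ext ω
        simp only [mem_inter_iff, mem_preimage, mem_singleton_iff, mem_ofPred_eq, funext_iff,
          Subtype.forall, s]
        constructor
        · rintro ⟨h, -⟩ k hk
          rw [dif_pos hk]; exact h k hk
        · intro h
          have h' : ∀ k (hk : k ≤ t), ω k = w ⟨k, hk⟩ := fun k hk => by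
            have := h k hk; rwa [dif_pos hk] at this
          exact ⟨h', (h' t le_rfl).trans hx⟩
      have e2 : Preorder.restrictLe (π := fun _ : ℕ => S) t ⁻¹' {w} ∩
            ({ω | ω t = x} ∩ {ω | ω (t + 1) = y})
          = {ω | ∀ k ≤ t + 1, ω k = s k} := by
        rw [← inter_assoc, e1]
        ext ω
        simp only [mem_inter_iff, mem_ofPred_eq, Nat.le_succ_iff_eq_or_le, forall_eq_or_imp]
        simp [s, and_comm]
      rw [e2, e1, X.μ_cylinder, X.μ_cylinder, Finset.prod_range_succ, ← mul_assoc, smul_eq_mul,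
        mul_comm (ENNReal.ofReal (X.P x y)), ENNReal.ofReal_mul (mul_nonneg (X.init_nonneg _)
          (Finset.prod_nonneg fun _ _ => X.P_nonneg _ _))]
      have hst : s t = x := by simp [s, hx]
      have hst' : s (t + 1) = y := by simp [s]
      rw [hst, hst']
    · have e1 : Preorder.restrictLe (π := fun _ : ℕ => S) t ⁻¹' {w} ∩ {ω | ω t = x} = ∅ := by
        ext ω
        simp only [mem_inter_iff, mem_preimage, mem_singleton_iff, mem_ofPred_eq, mem_empty_iff_false,
          iff_false, not_and]
        rintro rfl h
        exact hx h
      rw [← inter_assoc, e1]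
      simp
  have := congrArg (fun ν => ν B) key
  simp only [Measure.smul_apply] at this
  rw [Measure.map_apply hr hB, Measure.map_apply hr hB, Measure.restrict_apply (hr hB),
    Measure.restrict_apply (hr hB), smul_eq_mul, mul_comm, ← inter_assoc] at this
  exact this

lemma measurableSet_piLE_coord {s t : ℕ} (h : s ≤ t) (Q : Set S) :
    MeasurableSet[Filtration.piLE (X := fun _ : ℕ => S) t] {ω | ω s ∈ Q} :=
  ⟨{w | w ⟨s, h⟩ ∈ Q}, measurable_pi_apply _ Q.to_countable.measurableSet, rfl⟩

lemma measure_eq_tsum_coord (X : MarkovChain S) (H : Set (ℕ → S)) (t : ℕ) :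
    X.μ H = ∑' x, X.μ (H ∩ {ω | ω t = x}) := by
  have hd : Pairwise (Function.onFun Disjoint fun x : S => {ω : ℕ → S | ω t = x}) :=
    fun x y hxy => Set.disjoint_left.2 fun ω (h : ω t = x) (h' : ω t = y) => hxy (h ▸ h')
  have hU : ⋃ x : S, {ω : ℕ → S | ω t = x} = univ := by
    ext ω; simp
  have h := measure_iUnion (μ := X.μ.restrict H) hd fun x => measurableSet_coord t {x}
  rw [hU, Measure.restrict_apply_univ] at h
  rw [h]
  refine tsum_congr fun x => ?_
  have h' := Measure.restrict_apply (μ := X.μ) (s := H) (measurableSet_coord t {x})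
  rwa [inter_comm] at h'

/-- The Markov property over several steps, for an event of the past. -/
lemma measure_steps (X : MarkovChain S) {t : ℕ} {H : Set (ℕ → S)}
    (hH : MeasurableSet[Filtration.piLE (X := fun _ : ℕ => S) t] H) (s : ℕ) (x y : S) :
    X.μ (H ∩ {ω | ω t = x} ∩ {ω | ω (t + s) = y})
      = X.μ (H ∩ {ω | ω t = x}) * ENNReal.ofReal (X.Pn s x y) := by
  classical
  induction s generalizing y with
  | zero =>
    simp only [add_zero, Pn]
    split_ifs with h
    · subst h; simp [inter_assoc]
    · have : H ∩ {ω | ω t = x} ∩ {ω | ω t = y} = ∅ := by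
        ext ω; simp only [mem_inter_iff, mem_ofPred_eq, mem_empty_iff_false, iff_false]
        rintro ⟨⟨-, h1⟩, h2⟩; exact h (h1 ▸ h2)
      simp [this]
  | succ s ih =>
    rw [measure_eq_tsum_coord _ _ (t + s), ofReal_Pn_succ (X.summable_Pn s x),
      ← ENNReal.tsum_mul_left]
    refine tsum_congr fun z => ?_
    rw [← mul_assoc, ← ih z, ← add_assoc, inter_right_comm]
    refine X.measure_step ?_ z y
    exact ((Filtration.piLE.mono (Nat.le_add_right t s)) _ hH).inter
      (measurableSet_piLE_coord (Nat.le_add_right t s) {x})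

lemma eventually_measure_coord_pos {X : MarkovChain S} (hirr : X.Irreducible) (hap : X.Aperiodic)
    (x : S) : ∀ᶠ t in atTop, 0 < X.μ {ω | ω t = x} := by
  obtain ⟨i, hi⟩ : ∃ i, 0 < X.init i := by
    by_contra! h
    have : X.init = fun _ => 0 := funext fun i => le_antisymm (h i) (X.init_nonneg i)
    have h1 := X.init_hasSum.tsum_eq
    simp [this] at h1
  filter_upwards [eventually_Pn_pos hirr hap i x] with t ht
  have h0 : X.μ {ω | ω 0 = i} = ENNReal.ofReal (X.init i) := by
    simpa using X.μ_cylinder 0 fun _ => i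
  have h := X.measure_steps (t := 0) (H := univ) MeasurableSet.univ t i x
  rw [univ_inter, h0, zero_add] at h
  refine lt_of_lt_of_le ?_ (measure_mono (inter_subset_right (s := {ω : ℕ → S | ω 0 = i})))
  rw [h]
  exact ENNReal.mul_pos (by simpa using hi) (by simpa using ht)

lemma iSup_piLE : ⨆ t, Filtration.piLE (X := fun _ : ℕ => S) t
    = (MeasurableSpace.pi : MeasurableSpace (ℕ → S)) := by
  refine le_antisymm (iSup_le fun t => Filtration.piLE.le t) (iSup_le fun t => ?_)
  refine le_trans ?_ (le_iSup _ t)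
  rintro _ ⟨Q, -, rfl⟩
  exact measurableSet_piLE_coord le_rfl Q

lemma measure_ext_of_cylinder {ν₁ ν₂ : Measure (ℕ → S)} [IsFiniteMeasure ν₁]
    (h : ∀ (n : ℕ) (s : ℕ → S), ν₁ {ω | ∀ k ≤ n, ω k = s k} = ν₂ {ω | ∀ k ≤ n, ω k = s k}) :
    ν₁ = ν₂ := by
  have key : ∀ n, ∀ A, MeasurableSet[Filtration.piLE (X := fun _ : ℕ => S) n] A →
      ν₁ A = ν₂ A := by
    rintro n _ ⟨B, hB, rfl⟩
    have hr := Preorder.measurable_restrictLe (X := fun _ : ℕ => S) n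
    have h' : ν₁.map (Preorder.restrictLe n) = ν₂.map (Preorder.restrictLe n) := by
      refine Measure.ext_of_singleton fun w => ?_
      rw [Measure.map_apply hr (measurableSet_singleton w),
        Measure.map_apply hr (measurableSet_singleton w)]
      have e : Preorder.restrictLe (π := fun _ : ℕ => S) n ⁻¹' {w}
          = {ω | ∀ k ≤ n, ω k = (fun k => w ⟨min k n, min_le_right k n⟩) k} := by
        ext ω
        simp only [mem_preimage, mem_singleton_iff, mem_ofPred_eq, funext_iff, Subtype.forall]
        refine forall₂_congr fun k (hk : k ≤ n) => ?_
        simp only [min_eq_left hk]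
        rfl
      rw [e]
      exact h n _
    rw [← Measure.map_apply hr hB, ← Measure.map_apply hr hB, h']
  refine ext_of_generate_finite
    {A | ∃ n, MeasurableSet[Filtration.piLE (X := fun _ : ℕ => S) n] A} ?_ ?_ ?_ ?_
  · exact iSup_piLE.symm.trans (MeasurableSpace.measurableSpace_iSup_eq _)
  · rintro A ⟨a, ha⟩ B ⟨b, hb⟩ -
    exact ⟨max a b, (Filtration.piLE.mono (le_max_left a b) _ ha).inter
      (Filtration.piLE.mono (le_max_right a b) _ hb)⟩
  · rintro A ⟨n, hA⟩
    exact key n A hA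
  · exact key 0 univ MeasurableSet.univ

/-- The path seen from time `a` on. -/
def shiftBy (a : ℕ) (ω : ℕ → S) : ℕ → S := fun k => ω (a + k)

omit [Countable S] [MeasurableSingletonClass S] in
lemma measurable_shiftBy (a : ℕ) : Measurable (shiftBy a : (ℕ → S) → ℕ → S) :=
  measurable_pi_lambda _ fun k => measurable_pi_apply (a + k)

omit [MeasurableSpace S] [Countable S] [MeasurableSingletonClass S] in
lemma shiftBy_zero (ω : ℕ → S) : shiftBy 0 ω = ω :=
  funext fun k => congrArg ω (zero_add k)

omit [MeasurableSpace S] [Countable S] [MeasurableSingletonClass S] in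
lemma shiftBy_shiftBy (a b : ℕ) (ω : ℕ → S) : shiftBy a (shiftBy b ω) = shiftBy (b + a) ω :=
  funext fun k => congrArg ω (add_assoc b a k).symm

lemma measure_cylinder_after (X : MarkovChain S) (a : ℕ) (s : ℕ → S) (n : ℕ) :
    X.μ ({ω | ∀ k ≤ n, ω (a + k) = s k})
      = X.μ {ω | ω a = s 0} * ∏ k ∈ Finset.range n, ENNReal.ofReal (X.P (s k) (s (k + 1))) := by
  induction n with
  | zero => simp
  | succ n ih =>
    have hH : MeasurableSet[Filtration.piLE (X := fun _ : ℕ => S) (a + n)]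
        {ω : ℕ → S | ∀ k ≤ n, ω (a + k) = s k} := by
      simp only [ofPred_forall]
      exact MeasurableSet.iInter fun k => MeasurableSet.iInter fun hk =>
        measurableSet_piLE_coord (Nat.add_le_add_left hk a) {s k}
    have e1 : {ω : ℕ → S | ∀ k ≤ n, ω (a + k) = s k} ∩ {ω | ω (a + n) = s n}
        = {ω : ℕ → S | ∀ k ≤ n, ω (a + k) = s k} :=
      inter_eq_left.2 fun ω hω => hω n le_rfl
    have e2 : {ω : ℕ → S | ∀ k ≤ n + 1, ω (a + k) = s k}
        = {ω : ℕ → S | ∀ k ≤ n, ω (a + k) = s k} ∩ {ω | ω (a + n) = s n}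
          ∩ {ω | ω (a + n + 1) = s (n + 1)} := by
      rw [e1]
      ext ω
      simp only [mem_inter_iff, mem_ofPred_eq, Nat.le_succ_iff_eq_or_le, forall_eq_or_imp]
      rw [and_comm, add_assoc]
    rw [e2, X.measure_step hH, e1, ih, Finset.prod_range_succ, mul_assoc]

/-- Conditionally on the current state, the future has the same law at any two times. -/
lemma measure_future (X : MarkovChain S) (a b : ℕ) (x : S) {E : Set (ℕ → S)}
    (hE : MeasurableSet E) :
    X.μ {ω | ω b = x} * X.μ (shiftBy a ⁻¹' E ∩ {ω | ω a = x})
      = X.μ {ω | ω a = x} * X.μ (shiftBy b ⁻¹' E ∩ {ω | ω b = x}) := by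
  classical
  have key : X.μ {ω | ω b = x} • (X.μ.restrict {ω | ω a = x}).map (shiftBy a)
      = X.μ {ω | ω a = x} • (X.μ.restrict {ω | ω b = x}).map (shiftBy b) := by
    have : IsFiniteMeasure
        (X.μ {ω | ω b = x} • (X.μ.restrict {ω | ω a = x}).map (shiftBy a)) :=
      Measure.smul_finite _ (measure_ne_top _ _)
    refine measure_ext_of_cylinder fun n s => ?_
    have hc : MeasurableSet {ω : ℕ → S | ∀ k ≤ n, ω k = s k} := by
      simp only [ofPred_forall]
      exact MeasurableSet.iInter fun k => MeasurableSet.iInter fun _ =>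
        measurableSet_coord k {s k}
    have hval : ∀ a, ((X.μ.restrict {ω | ω a = x}).map (shiftBy a)) {ω | ∀ k ≤ n, ω k = s k}
        = X.μ {ω | ω a = x} * (if s 0 = x then
          ∏ k ∈ Finset.range n, ENNReal.ofReal (X.P (s k) (s (k + 1))) else 0) := by
      intro a
      rw [Measure.map_apply (measurable_shiftBy a) hc,
        Measure.restrict_apply (measurable_shiftBy a hc)]
      split_ifs with h
      · have e : shiftBy a ⁻¹' {ω : ℕ → S | ∀ k ≤ n, ω k = s k} ∩ {ω | ω a = x}
            = {ω : ℕ → S | ∀ k ≤ n, ω (a + k) = s k} :=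
          inter_eq_left.2 fun ω hω => (hω 0 (Nat.zero_le n)).trans h
        rw [e, measure_cylinder_after, h]
      · have e : shiftBy a ⁻¹' {ω : ℕ → S | ∀ k ≤ n, ω k = s k} ∩ {ω | ω a = x} = ∅ := by
          rw [← disjoint_iff_inter_eq_empty, Set.disjoint_left]
          exact fun ω hω (hx : ω a = x) => h ((hω 0 (Nat.zero_le n)).symm.trans hx)
        rw [e, measure_empty, mul_zero]
    rw [Measure.smul_apply, Measure.smul_apply, hval, hval, smul_eq_mul, smul_eq_mul]
    ring
  have h := congrArg (fun ν => ν E) key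
  simp only [Measure.smul_apply, smul_eq_mul] at h
  rwa [Measure.map_apply (measurable_shiftBy _) hE, Measure.map_apply (measurable_shiftBy _) hE,
    Measure.restrict_apply (measurable_shiftBy _ hE),
    Measure.restrict_apply (measurable_shiftBy _ hE)] at h

/-- An almost sure event invariant under the `m`-step shift is almost surely seen from every
time on. -/
lemma ae_forall_shiftBy {X : MarkovChain S} (hirr : X.Irreducible) (hap : X.Aperiodic)
    {m : ℕ} (hm : 1 ≤ m) {p : (ℕ → S) → Prop} (hp : MeasurableSet {ω | p ω})
    (hinv : ∀ ω, p (shiftBy m ω) ↔ p ω) (h : ∀ᵐ ω ∂X.μ, p ω) :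
    ∀ᵐ ω ∂X.μ, ∀ s, p (shiftBy s ω) := by
  have hinv' : ∀ l ω, p (shiftBy (l * m) ω) ↔ p ω := by
    intro l ω
    induction l with
    | zero => rw [zero_mul, shiftBy_zero]
    | succ l ih => rw [← ih, ← hinv (shiftBy (l * m) ω), shiftBy_shiftBy, Nat.succ_mul]
  refine ae_all_iff.2 fun s => ?_
  rw [ae_iff]
  have hN : MeasurableSet {ω | ¬ p ω} := hp.compl
  change X.μ (shiftBy s ⁻¹' {ω | ¬ p ω}) = 0
  rw [measure_eq_tsum_coord X _ s, ENNReal.tsum_eq_zero]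
  intro x
  obtain ⟨T, hT⟩ := eventually_atTop.1 (eventually_measure_coord_pos hirr hap x)
  have hpos := hT (T * m) (Nat.le_mul_of_pos_right T hm)
  have hf := X.measure_future s (T * m) x hN
  have h0 : X.μ (shiftBy (T * m) ⁻¹' {ω | ¬ p ω} ∩ {ω | ω (T * m) = x}) = 0 := by
    refine measure_mono_null inter_subset_left ?_
    have : shiftBy (T * m) ⁻¹' {ω | ¬ p ω} = {ω | ¬ p ω} := by
      ext ω; exact not_congr (hinv' T ω)
    rw [this]
    exact ae_iff.1 h
  rw [h0, mul_zero, mul_eq_zero] at hf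
  exact hf.resolve_left hpos.ne'

/-- If from every state of `Q` the relation `R` between the current state and the state `s` steps
later has conditional probability at least `δ`, then the same holds given any event of the past. -/
lemma mul_measure_le (X : MarkovChain S) {t : ℕ} {H : Set (ℕ → S)}
    (hH : MeasurableSet[Filtration.piLE (X := fun _ : ℕ => S) t] H) {s : ℕ} {Q : Set S}
    {R : S → Set S} {δ : ℝ≥0∞}
    (hQ : ∀ x ∈ Q, δ ≤ ∑' y, (R x).indicator (fun y => ENNReal.ofReal (X.Pn s x y)) y)
    (hHQ : ∀ ω ∈ H, ω t ∈ Q) :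
    δ * X.μ H ≤ X.μ (H ∩ {ω | ω (t + s) ∈ R (ω t)}) := by
  classical
  rw [measure_eq_tsum_coord X H t, measure_eq_tsum_coord X (H ∩ _) t, ← ENNReal.tsum_mul_left]
  refine ENNReal.tsum_le_tsum fun x => ?_
  by_cases hx : x ∈ Q
  · calc δ * X.μ (H ∩ {ω | ω t = x})
        ≤ (∑' y, (R x).indicator (fun y => ENNReal.ofReal (X.Pn s x y)) y)
            * X.μ (H ∩ {ω | ω t = x}) := by gcongr; exact hQ x hx
      _ = ∑' y, X.μ (H ∩ {ω | ω (t + s) ∈ R (ω t)} ∩ {ω | ω t = x} ∩ {ω | ω (t + s) = y}) := by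
        rw [← ENNReal.tsum_mul_right]
        refine tsum_congr fun y => ?_
        by_cases hy : y ∈ R x
        · rw [indicator_of_mem hy, mul_comm, ← X.measure_steps hH]
          congr 1
          ext ω
          simp only [mem_inter_iff, mem_ofPred_eq]
          constructor
          · rintro ⟨⟨h1, rfl⟩, rfl⟩; exact ⟨⟨⟨h1, hy⟩, rfl⟩, rfl⟩
          · rintro ⟨⟨⟨h1, -⟩, h2⟩, h3⟩; exact ⟨⟨h1, h2⟩, h3⟩
        · rw [indicator_of_notMem hy, zero_mul]
          refine (measure_mono_null (fun ω hω => ?_) measure_empty).symm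
          obtain ⟨⟨⟨-, h1⟩, h2⟩, h3⟩ := hω
          simp only [mem_ofPred_eq] at h1 h2 h3
          rw [h2, h3] at h1
          exact hy h1
      _ = _ := (measure_eq_tsum_coord X _ (t + s)).symm
  · have : H ∩ {ω | ω t = x} = ∅ := by
      rw [← disjoint_iff_inter_eq_empty, Set.disjoint_left]
      exact fun ω hω (h : ω t = x) => hx (h ▸ hHQ ω hω)
    simp [this]

/-- A conditional second Borel–Cantelli lemma. -/
lemma ae_frequently_of_frequently (X : MarkovChain S) (m : ℕ) (hm : 1 ≤ m) (K : Set ℕ) (s : ℕ)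
    (Q : Set S) (R : S → Set S) {δ : ℝ} (hδ : 0 < δ)
    (hQ : ∀ x ∈ Q, ENNReal.ofReal δ
      ≤ ∑' y, (R x).indicator (fun y => ENNReal.ofReal (X.Pn s x y)) y) :
    ∀ᵐ ω ∂X.μ, (∃ᶠ k in atTop, k ∈ K ∧ ω (k * m) ∈ Q) →
      ∃ᶠ k in atTop, k ∈ K ∧ ω (k * m) ∈ Q ∧ ω (k * m + s) ∈ R (ω (k * m)) := by
  let V : ℕ → Set (ℕ → S) := fun N =>
    {ω | ∀ k, N ≤ k → k ∈ K → ω (k * m) ∈ Q → ω (k * m + s) ∉ R (ω (k * m))}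
  have hRm : ∀ t, MeasurableSet {ω : ℕ → S | ω (t + s) ∈ R (ω t)} := by
    intro t
    have : {ω : ℕ → S | ω (t + s) ∈ R (ω t)}
        = (fun ω : ℕ → S => (ω t, ω (t + s))) ⁻¹' {z | z.2 ∈ R z.1} := rfl
    rw [this]
    exact ((measurable_pi_apply t).prodMk (measurable_pi_apply (t + s)))
      (Set.to_countable _).measurableSet
  have hV : ∀ N, MeasurableSet (V N) := by
    intro N
    refine measurableSet_setOfPred.2 (Measurable.forall fun k => Measurable.imp measurable_const
      (Measurable.imp measurable_const (Measurable.imp ?_ (Measurable.not ?_))))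
    · exact measurableSet_setOfPred.1 (measurableSet_coord (k * m) Q)
    · exact measurableSet_setOfPred.1 (hRm (k * m))
  have hlevy : ∀ N, ∀ᵐ ω ∂X.μ, Tendsto
      (fun t => (X.μ[(V N).indicator (fun _ => (1 : ℝ)) |
        Filtration.piLE (X := fun _ : ℕ => S) t]) ω) atTop
      (nhds ((V N).indicator (fun _ => (1 : ℝ)) ω)) := fun N =>
    Integrable.tendsto_ae_condExp ((integrable_const 1).indicator (hV N)) (by
      rw [iSup_piLE]
      exact (stronglyMeasurable_const).indicator (hV N))
  have hbound : ∀ N k, N ≤ k → k ∈ K → ∀ᵐ ω ∂X.μ, ω (k * m) ∈ Q →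
      (X.μ[(V N).indicator (fun _ => (1 : ℝ)) |
        Filtration.piLE (X := fun _ : ℕ => S) (k * m)]) ω ≤ 1 - δ := by
    intro N k hNk hk
    have hle := (Filtration.piLE (X := fun _ : ℕ => S)).le (k * m)
    set f := X.μ[(V N).indicator (fun _ => (1 : ℝ)) |
        Filtration.piLE (X := fun _ : ℕ => S) (k * m)] with hf
    let B : Set (ℕ → S) := {ω | ω (k * m) ∈ Q} ∩ {ω | 1 - δ < f ω}
    have hfm : StronglyMeasurable[Filtration.piLE (X := fun _ : ℕ => S) (k * m)] f :=
      stronglyMeasurable_condExp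
    have hB : MeasurableSet[Filtration.piLE (X := fun _ : ℕ => S) (k * m)] B :=
      (measurableSet_piLE_coord le_rfl Q).inter
        (hfm.measurable measurableSet_Ioi)
    have h1 := X.mul_measure_le hB hQ (fun ω hω => hω.1)
    have h2 : X.μ (V N ∩ B) + ENNReal.ofReal δ * X.μ B ≤ X.μ B := by
      calc X.μ (V N ∩ B) + ENNReal.ofReal δ * X.μ B
          ≤ X.μ (B ∩ V N) + X.μ (B \ V N) := by
            rw [inter_comm]
            gcongr
            refine h1.trans (measure_mono fun ω hω => ⟨hω.1, fun hωV => ?_⟩)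
            exact hωV k hNk hk hω.1.1 hω.2
        _ = X.μ B := measure_inter_add_sdiff _ (hV N)
    have h3 : X.μ.real (V N ∩ B) + δ * X.μ.real B ≤ X.μ.real B := by
      have := ENNReal.toReal_mono (measure_ne_top _ _) h2
      rwa [ENNReal.toReal_add (measure_ne_top _ _) (ENNReal.mul_ne_top ENNReal.ofReal_ne_top
        (measure_ne_top _ _)), ENNReal.toReal_mul, ENNReal.toReal_ofReal hδ.le] at this
    have hint : Integrable (fun ω => f ω - (1 - δ)) X.μ :=
      integrable_condExp.sub (integrable_const _)
    have h4 : ∫ ω in B, (f ω - (1 - δ)) ∂X.μ ≤ 0 := by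
      rw [integral_sub integrable_condExp.integrableOn (integrable_const _),
        setIntegral_condExp hle ((integrable_const 1).indicator (hV N)) hB,
        setIntegral_indicator (hV N)]
      simp only [setIntegral_const, smul_eq_mul, mul_one]
      rw [inter_comm B]
      linarith
    have h5 : X.μ B = 0 := by
      by_contra hne
      have := (setIntegral_pos_iff_support_of_nonneg_ae (μ := X.μ) (s := B)
        (f := fun ω => f ω - (1 - δ)) ?_ hint.integrableOn).2 ?_
      · linarith
      · refine (ae_restrict_mem (hle _ hB)).mono fun ω hω => ?_
        exact (sub_pos.2 hω.2).le
      · have hsub : B ⊆ Function.support fun ω => f ω - (1 - δ) :=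
          fun ω hω => (sub_pos.2 hω.2).ne'
        rw [inter_eq_right.2 hsub]
        exact pos_iff_ne_zero.2 hne
    have h6 : ∀ᵐ ω ∂X.μ, ω ∉ B := measure_eq_zero_iff_ae_notMem.1 h5
    filter_upwards [h6] with ω hω hωQ
    by_contra hlt
    exact hω ⟨hωQ, not_le.1 hlt⟩
  have hbound' : ∀ᵐ ω ∂X.μ, ∀ N k, N ≤ k → k ∈ K → ω (k * m) ∈ Q →
      (X.μ[(V N).indicator (fun _ => (1 : ℝ)) |
        Filtration.piLE (X := fun _ : ℕ => S) (k * m)]) ω ≤ 1 - δ := by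
    refine ae_all_iff.2 fun N => ae_all_iff.2 fun k => ?_
    by_cases h : N ≤ k ∧ k ∈ K
    · filter_upwards [hbound N k h.1 h.2] with ω hω _ _ using hω
    · exact Eventually.of_forall fun ω h1 h2 => absurd ⟨h1, h2⟩ h
  filter_upwards [ae_all_iff.2 hlevy, hbound'] with ω hω1 hω2 hfreq
  by_contra hcon
  rw [not_frequently, eventually_atTop] at hcon
  obtain ⟨N, hN⟩ := hcon
  have hmem : ω ∈ V N := fun k hk hkK hkQ hkR => hN k hk ⟨hkK, hkQ, hkR⟩
  have hlim := hω1 N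
  rw [indicator_of_mem hmem] at hlim
  have hlim' := (hlim.comp (tendsto_id.atTop_mul_const' hm)).eventually
    (lt_mem_nhds (show 1 - δ < 1 by linarith))
  obtain ⟨k, ⟨hk, hkQ⟩, hkl, hkN⟩ :=
    (hfreq.and_eventually (hlim'.and (eventually_ge_atTop N))).exists
  exact absurd (hω2 N k hkN hk hkQ) (not_le.2 hkl)

omit [MeasurableSingletonClass S] [Countable S] in
lemma mem_U_iff (X : MarkovChain S) {m : ℕ} {C : Set S} {ω : ℕ → S} :
    ω ∈ X.U m C ↔ ∃ᶠ k in atTop, ω (k * m) ∈ C :=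
  frequently_atTop.symm

omit [MeasurableSingletonClass S] [Countable S] in
lemma mem_L_iff (X : MarkovChain S) {m : ℕ} {C : Set S} {ω : ℕ → S} :
    ω ∈ X.L m C ↔ ∀ᶠ k in atTop, ω (k * m) ∈ C :=
  eventually_atTop.symm

omit [MeasurableSingletonClass S] [Countable S] in
lemma L_subset_U (X : MarkovChain S) (m : ℕ) (C : Set S) : X.L m C ⊆ X.U m C := fun _ hω =>
  X.mem_U_iff.2 (X.mem_L_iff.1 hω).frequently

lemma measurableSet_U (X : MarkovChain S) (m : ℕ) (C : Set S) : MeasurableSet (X.U m C) :=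
  measurableSet_setOfPred.2 <| .forall fun _ => .exists fun k => .and measurable_const <|
    measurableSet_setOfPred.1 (measurableSet_coord (k * m) C)

lemma measurableSet_L (X : MarkovChain S) (m : ℕ) (C : Set S) : MeasurableSet (X.L m C) :=
  measurableSet_setOfPred.2 <| .exists fun _ => .forall fun k => .imp measurable_const <|
    measurableSet_setOfPred.1 (measurableSet_coord (k * m) C)

omit [MeasurableSingletonClass S] [Countable S] in
lemma shiftBy_mem_L_iff (X : MarkovChain S) {m : ℕ} {C : Set S} {ω : ℕ → S} :
    shiftBy m ω ∈ X.L m C ↔ ω ∈ X.L m C := by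
  have h : (∀ᶠ k in atTop, ω (k * m) ∈ C) ↔ ∀ᶠ k in atTop, ω ((k + 1) * m) ∈ C := by
    conv_lhs => rw [← map_add_atTop_eq_nat 1]
    rw [eventually_map]
  rw [mem_L_iff, mem_L_iff, h]
  simp only [shiftBy, Nat.succ_mul, add_comm m]

omit [MeasurableSingletonClass S] [Countable S] in
lemma shiftBy_mem_U_iff (X : MarkovChain S) {m : ℕ} {C : Set S} {ω : ℕ → S} :
    shiftBy m ω ∈ X.U m C ↔ ω ∈ X.U m C := by
  have h : (∃ᶠ k in atTop, ω (k * m) ∈ C) ↔ ∃ᶠ k in atTop, ω ((k + 1) * m) ∈ C := by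
    conv_lhs => rw [← map_add_atTop_eq_nat 1]
    rw [frequently_map]
  rw [mem_U_iff, mem_U_iff, h]
  simp only [shiftBy, Nat.succ_mul, add_comm m]

omit [MeasurableSingletonClass S] [Countable S] in
lemma shiftBy_mul_mem_L_iff (X : MarkovChain S) {m : ℕ} {C : Set S} {ω : ℕ → S} (l : ℕ) :
    shiftBy (l * m) ω ∈ X.L m C ↔ ω ∈ X.L m C := by
  induction l with
  | zero => rw [zero_mul, shiftBy_zero]
  | succ l ih => rw [Nat.succ_mul, ← shiftBy_shiftBy, shiftBy_mem_L_iff, ih]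

omit [MeasurableSingletonClass S] [Countable S] in
lemma regular_iff (X : MarkovChain S) {m : ℕ} {C : Set S} :
    X.Regular m C ↔ ∀ᵐ ω ∂X.μ, ω ∈ X.U m C → ω ∈ X.L m C := by
  rw [Regular, Set.symmDiff_def, sdiff_eq_empty.2 (X.L_subset_U m C), union_empty,
    measure_eq_zero_iff_ae_notMem]
  simp

omit [MeasurableSingletonClass S] [Countable S] in
lemma Regular.compl {X : MarkovChain S} {m : ℕ} {C : Set S} (h : X.Regular m C) :
    X.Regular m Cᶜ := by
  rw [regular_iff] at h ⊢
  filter_upwards [h] with ω hω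
  rw [mem_U_iff, mem_L_iff] at hω ⊢
  intro hf
  by_contra hcon
  rw [not_eventually] at hcon
  obtain ⟨k, h1, h2⟩ := (hf.and_eventually (hω (hcon.mono fun k hk => not_not.1 hk))).exists
  exact h1 h2

omit [MeasurableSingletonClass S] [Countable S] in
lemma Regular.inter {X : MarkovChain S} {m : ℕ} {C D : Set S} (hC : X.Regular m C)
    (hD : X.Regular m D) : X.Regular m (C ∩ D) := by
  rw [regular_iff] at hC hD ⊢
  filter_upwards [hC, hD] with ω h1 h2 h
  rw [mem_U_iff] at h1 h2 h
  rw [mem_L_iff] at h1 h2 ⊢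
  exact (h1 (h.mono fun _ hk => hk.1)).and (h2 (h.mono fun _ hk => hk.2))

lemma Regular.ae_shiftBy {X : MarkovChain S} (hirr : X.Irreducible) (hap : X.Aperiodic)
    {m : ℕ} (hm : 1 ≤ m) {C : Set S} (h : X.Regular m C) :
    ∀ᵐ ω ∂X.μ, ∀ s, shiftBy s ω ∈ X.U m C → shiftBy s ω ∈ X.L m C := by
  refine ae_forall_shiftBy (p := fun ω => ω ∈ X.U m C → ω ∈ X.L m C) hirr hap hm ?_
    (fun ω => ?_) (X.regular_iff.1 h)
  · exact measurableSet_setOfPred.2 <| .imp (measurableSet_setOfPred.1 (X.measurableSet_U m C))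
      (measurableSet_setOfPred.1 (X.measurableSet_L m C))
  · rw [shiftBy_mem_L_iff, shiftBy_mem_U_iff]

lemma exists_frequently_mod {m : ℕ} (hm : 1 ≤ m) {p : ℕ → Prop} (h : ∃ᶠ k in atTop, p k) :
    ∃ j < m, ∃ᶠ k in atTop, k % m = j ∧ p k := by
  refine (frequently_exists_finite (finite_lt_nat m)).1 (h.mono fun k hk => ?_)
  exact ⟨k % m, Nat.mod_lt k hm, rfl, hk⟩

/-- A path eventually in `C` at multiples of `m` is infinitely often in `C` `n` steps later. -/
lemma ae_shiftBy_mem_U {X : MarkovChain S} (hap : X.Aperiodic) {n : ℕ} {δ : ℝ} (hδ : 0 < δ)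
    (hfin : {i : S | X.Pn n i i < δ}.Finite) {m : ℕ} (hm : 1 ≤ m) (C : Set S) :
    ∀ᵐ ω ∂X.μ, ω ∈ X.L m C → shiftBy n ω ∈ X.U m C := by
  set F := {i : S | X.Pn n i i < δ} with hF
  have hself : ∀ s x, ∑' y, ({x} : Set S).indicator (fun y => ENNReal.ofReal (X.Pn s x y)) y
      = ENNReal.ofReal (X.Pn s x x) := by
    intro s x
    rw [tsum_eq_single x fun y hy => indicator_of_notMem (by simpa using hy) _]
    simp
  have h1 := X.ae_frequently_of_frequently m hm univ n Fᶜ (fun x => {x}) hδ fun x hx => by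
    rw [hself]
    exact ENNReal.ofReal_le_ofReal (not_lt.1 hx)
  choose N hN using fun j => eventually_atTop.1 (eventually_Pn_self_pos hap j)
  have h2 : ∀ j : S, _ := fun j =>
    X.ae_frequently_of_frequently m hm univ (n + N j * m) {j} (fun x => {x})
      (hN j (n + N j * m) ((Nat.le_mul_of_pos_right _ hm).trans (Nat.le_add_left _ _)))
      fun x hx => by
        rw [hself, mem_singleton_iff.1 hx]
  filter_upwards [h1, ae_all_iff.2 h2] with ω hω1 hω2 hL
  rw [mem_L_iff] at hL
  rw [mem_U_iff]
  simp only [mem_univ, true_and, mem_singleton_iff] at hω1 hω2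
  by_cases hfr : ∃ᶠ k in atTop, ω (k * m) ∈ Fᶜ
  · refine ((hω1 hfr).and_eventually hL).mono fun k hk => ?_
    change ω (n + k * m) ∈ C
    rw [add_comm, hk.1.2]
    exact hk.2
  · have hev : ∀ᶠ k in atTop, ∃ j ∈ F, ω (k * m) = j := by
      filter_upwards [not_frequently.1 hfr] with k hk
      exact ⟨_, not_not.1 hk, rfl⟩
    obtain ⟨j, -, hj⟩ := (frequently_exists_finite hfin).1 hev.frequently
    refine (tendsto_add_atTop_nat (N j)).frequently
      (((hω2 j hj).and_eventually hL).mono fun k hk => ?_)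
    change ω (n + (k + N j) * m) ∈ C
    have e : n + (k + N j) * m = k * m + (n + N j * m) := by ring
    rw [e, hk.1.2]
    exact hk.2

lemma tendsto_div_mul_atTop {a b : ℕ} (ha : 1 ≤ a) (hb : 1 ≤ b) :
    Tendsto (fun k : ℕ => k / a * b) atTop atTop :=
  (Nat.tendsto_div_const_atTop (by omega)).atTop_mul_const' hb

/-- If the `n`-step chain is sticky, then a set regular for the `m`-step chain is visited
infinitely often, respectively eventually always, by the `n`-step chain exactly when it is
by the `m`-step chain. -/
lemma Regular.ae_transfer {X : MarkovChain S} (hirr : X.Irreducible) (hap : X.Aperiodic)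
    {n : ℕ} (hn : 1 ≤ n) {δ : ℝ} (hδ : 0 < δ) (hfin : {i : S | X.Pn n i i < δ}.Finite)
    {m : ℕ} (hm : 1 ≤ m) {C : Set S} (hC : X.Regular m C) :
    ∀ᵐ ω ∂X.μ, (ω ∈ X.U n C → ω ∈ X.L m C) ∧ (ω ∈ X.L m C → ω ∈ X.L n C) := by
  have h0 := hC.ae_shiftBy hirr hap hm
  have h1 : ∀ᵐ ω ∂X.μ, ω ∈ X.L m C → shiftBy n ω ∈ X.L m C := by
    filter_upwards [h0, ae_shiftBy_mem_U hap hδ hfin hm C] with ω h2 h3 h4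
    exact h2 n (h3 h4)
  have h2 : ∀ᵐ ω ∂X.μ, ∀ s, shiftBy s ω ∈ X.L m C → shiftBy n (shiftBy s ω) ∈ X.L m C := by
    refine ae_forall_shiftBy (p := fun ω => ω ∈ X.L m C → shiftBy n ω ∈ X.L m C)
      hirr hap hm ?_ (fun ω => ?_) h1
    · exact measurableSet_setOfPred.2 <|
        .imp (measurableSet_setOfPred.1 (X.measurableSet_L m C))
          (measurableSet_setOfPred.1 (measurable_shiftBy n (X.measurableSet_L m C)))
    · rw [shiftBy_shiftBy, add_comm, ← shiftBy_shiftBy, shiftBy_mem_L_iff, shiftBy_mem_L_iff]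
  filter_upwards [h0, h2] with ω hω0 hω2
  have hstep : ∀ s j, shiftBy s ω ∈ X.L m C → shiftBy (s + j * n) ω ∈ X.L m C := by
    intro s j hs
    induction j with
    | zero => rwa [zero_mul, add_zero]
    | succ j ih =>
      have := hω2 _ ih
      rwa [shiftBy_shiftBy, add_assoc, ← Nat.succ_mul] at this
  have hdecomp : ∀ k, k % m * n + k / m * n * m = k * n := by
    intro k
    conv_rhs => rw [← Nat.mod_add_div k m]
    ring
  constructor
  · intro hU
    obtain ⟨j, hj, hfr⟩ := exists_frequently_mod hm (X.mem_U_iff.1 hU)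
    have hjU : shiftBy (j * n) ω ∈ X.U m C := by
      rw [mem_U_iff]
      refine (tendsto_div_mul_atTop hm hn).frequently (hfr.mono fun k hk => ?_)
      change ω (j * n + k / m * n * m) ∈ C
      rw [← hk.1, hdecomp]
      exact hk.2
    have h := hstep _ (m - j) (hω0 _ hjU)
    rwa [← add_mul, Nat.add_sub_cancel' hj.le, mul_comm, shiftBy_mul_mem_L_iff] at h
  · intro hL
    have hall : ∀ᶠ k in atTop, ∀ j ∈ {j | j < m}, ω (j * n + k * m) ∈ C := by
      refine (eventually_all_finite (finite_lt_nat m)).2 fun j _ => ?_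
      have h := hstep 0 j (by rwa [shiftBy_zero])
      rw [zero_add, mem_L_iff] at h
      exact h
    rw [mem_L_iff]
    filter_upwards [(tendsto_div_mul_atTop hm hn).eventually hall] with k hk
    rw [← hdecomp]
    exact hk (k % m) (Nat.mod_lt k hm)

lemma AlmostClosed.transfer {X : MarkovChain S} (hirr : X.Irreducible) (hap : X.Aperiodic)
    {n : ℕ} (hn : 1 ≤ n) {δ : ℝ} (hδ : 0 < δ) (hfin : {i : S | X.Pn n i i < δ}.Finite)
    {m : ℕ} (hm : 1 ≤ m) {C : Set S} (hC : X.AlmostClosed m C) : X.AlmostClosed n C := by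
  have h := hC.1.ae_transfer hirr hap hn hδ hfin hm
  refine ⟨X.regular_iff.2 (h.mono fun ω hω hU => hω.2 (hω.1 hU)), fun hT => hC.2 ?_⟩
  rw [Transient, measure_eq_zero_iff_ae_notMem] at hT ⊢
  filter_upwards [h, hT, X.regular_iff.1 hC.1] with ω h1 h2 h3 h4
  exact h2 (X.L_subset_U _ _ (h1.2 (h3 h4)))

/-- The event that some shift of the path by a multiple of `m` is eventually in `A` at multiples
of `n` is carried by a set of states, for the `m`-step chain. -/
lemma Regular.exists_hull {X : MarkovChain S} (hirr : X.Irreducible) (hap : X.Aperiodic)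
    {n : ℕ} (hn : 1 ≤ n) {m : ℕ} (hm : 1 ≤ m) {A : Set S} (hA : X.Regular n A) :
    ∃ T : Set S, ∀ᵐ ω ∂X.μ,
      (ω ∈ X.U m T → ∃ s < n, shiftBy (s * m) ω ∈ X.L n A) ∧
      ((∃ s < n, shiftBy (s * m) ω ∈ X.L n A) → ω ∈ X.L m T) := by
  let mass : Set S → ℕ → S → ℝ≥0∞ := fun B t x =>
    ∑' y, B.indicator (fun y => ENNReal.ofReal (X.Pn (t * m) x y)) y
  have hhalf : (0 : ℝ) < 1 / 2 := by norm_num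
  let Q : ℕ → Set S := fun t => {x | ENNReal.ofReal (1 / 2) ≤ mass A t x}
  have hQc : ∀ t, ∀ x ∈ (Q t)ᶜ, ENNReal.ofReal (1 / 2) ≤ mass Aᶜ t x := by
    intro t x hx
    have h1 : mass A t x + mass Aᶜ t x = 1 := by
      rw [← X.tsum_ofReal_Pn (t * m) x, ← ENNReal.tsum_add]
      exact tsum_congr fun y => indicator_self_add_compl_apply A _ y
    by_contra! hlt
    have h2 : mass A t x < ENNReal.ofReal (1 / 2) := not_le.1 hx
    have h3 := ENNReal.add_lt_add h2 hlt
    rw [h1, ← ENNReal.ofReal_add hhalf.le hhalf.le] at h3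
    norm_num at h3
  have hin : ∀ t r, _ := fun t r =>
    X.ae_frequently_of_frequently m hm {k | k % n = r} (t * m) (Q t) (fun _ => A) hhalf
      fun x hx => hx
  have hout : ∀ t r, _ := fun t r =>
    X.ae_frequently_of_frequently m hm {k | k % n = r} (t * m) (Q t)ᶜ (fun _ => Aᶜ) hhalf
      (hQc t)
  have hdecomp : ∀ k t s, (k + t) % n = s → s * m + (k + t) / n * m * n = k * m + t * m := by
    rintro k t s rfl
    rw [← add_mul]
    conv_rhs => rw [← Nat.mod_add_div (k + t) n]
    ring
  have htend : ∀ t, Tendsto (fun k : ℕ => (k + t) / n * m) atTop atTop := fun t =>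
    (tendsto_div_mul_atTop hn hm).comp (tendsto_add_atTop_nat t)
  refine ⟨{x | ∃ t ∈ {t | t < n}, x ∈ Q t}, ?_⟩
  filter_upwards [ae_all_iff.2 fun t => ae_all_iff.2 (hin t),
    ae_all_iff.2 fun t => ae_all_iff.2 (hout t), hA.ae_shiftBy hirr hap hn] with ω hωi hωo hωs
  constructor
  · intro hU
    obtain ⟨t, -, ht⟩ := (frequently_exists_finite (finite_lt_nat n)).1 (X.mem_U_iff.1 hU)
    obtain ⟨r, -, hr⟩ := exists_frequently_mod hn ht
    refine ⟨(r + t) % n, Nat.mod_lt _ hn, hωs _ (X.mem_U_iff.2 ?_)⟩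
    refine (htend t).frequently ((hωi t r hr).mono fun k hk => ?_)
    change ω ((r + t) % n * m + (k + t) / n * m * n) ∈ A
    rw [hdecomp k t _ (by rw [← (show k % n = r from hk.1), Nat.mod_add_mod])]
    exact hk.2.2
  · rintro ⟨s, hs, hL⟩
    rw [mem_L_iff] at hL ⊢
    by_contra hcon
    obtain ⟨r, hrn, hr⟩ := exists_frequently_mod hn (not_eventually.1 hcon)
    let t := (s + (n - r)) % n
    have htn : t < n := Nat.mod_lt _ hn
    have hrt : (r + t) % n = s := by
      rw [Nat.add_mod_mod, show r + (s + (n - r)) = s + n by omega, Nat.add_mod_right,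
        Nat.mod_eq_of_lt hs]
    have hr' : ∃ᶠ k in atTop, k % n = r ∧ ω (k * m) ∈ (Q t)ᶜ :=
      hr.mono fun k hk => ⟨hk.1, fun hq => hk.2 ⟨t, htn, hq⟩⟩
    obtain ⟨k, hk, hkA⟩ := ((hωo t r hr').and_eventually ((htend t).eventually hL)).exists
    refine hk.2.2 ?_
    rw [← hdecomp k t s (by rw [← hrt, ← (show k % n = r from hk.1), Nat.mod_add_mod])]
    exact hkA

omit [MeasurableSingletonClass S] [Countable S] in
lemma exists_pairwise_disjoint_almostClosed {X : MarkovChain S} {n : ℕ} {D : Set S}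
    (hD : ∀ A ⊆ D, ¬ X.Atomic n A) (N : ℕ) {A : Set S} (hAD : A ⊆ D)
    (hA : X.AlmostClosed n A) :
    ∃ f : Fin (N + 1) → Set S, (∀ i, f i ⊆ A ∧ X.AlmostClosed n (f i)) ∧
      Pairwise (Function.onFun Disjoint f) := by
  induction N generalizing A with
  | zero => exact ⟨fun _ => A, fun _ => ⟨Subset.rfl, hA⟩,
    fun i j hij => absurd (Subsingleton.elim (α := Fin 1) i j) hij⟩
  | succ N ih =>
    have h := hD A hAD
    rw [Atomic, not_and, not_not] at h
    obtain ⟨B, B', hB, hB', hdisj, hBc, hBc'⟩ := h hA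
    obtain ⟨f, hf, hfd⟩ := ih (hB'.trans hAD) hBc'
    refine ⟨Fin.cons B f, Fin.cases ⟨hB, hBc⟩ fun i => ⟨(hf i).1.trans hB', (hf i).2⟩, ?_⟩
    intro i j hij
    induction i using Fin.cases with
    | zero =>
      induction j using Fin.cases with
      | zero => exact absurd rfl hij
      | succ j => exact hdisj.mono_right (hf j).1
    | succ i =>
      induction j using Fin.cases with
      | zero => exact (hdisj.mono_right (hf i).1).symm
      | succ j => exact hfd fun h => hij (congrArg Fin.succ h)

omit [MeasurableSingletonClass S] [Countable S] in
/-- An almost closed subset of an atomic set is almost all of it. -/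
lemma Atomic.ae_of_subset {X : MarkovChain S} {m : ℕ} {C T : Set S} (hC : X.Atomic m C)
    (hT : X.Regular m T) (hCT : ¬ X.Transient m (C ∩ T)) :
    ∀ᵐ ω ∂X.μ, ω ∈ X.L m C → ω ∈ X.L m T := by
  have h : X.Transient m (C ∩ Tᶜ) := by
    by_contra hnt
    exact hC.2 ⟨C ∩ T, C ∩ Tᶜ, inter_subset_left, inter_subset_left,
      disjoint_compl_right.mono inter_subset_right inter_subset_right,
      ⟨hC.1.1.inter hT, hCT⟩, ⟨hC.1.1.inter hT.compl, hnt⟩⟩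
  rw [Transient, measure_eq_zero_iff_ae_notMem] at h
  filter_upwards [h] with ω hω hL
  rw [mem_U_iff, not_frequently] at hω
  rw [mem_L_iff] at hL ⊢
  filter_upwards [hω, hL] with k h1 h2
  by_contra h3
  exact h1 ⟨h2, h3⟩

omit [MeasurableSingletonClass S] [Countable S] in
lemma AlmostClosed.inter_of_ae {X : MarkovChain S} {n : ℕ} {A D : Set S}
    (hA : X.AlmostClosed n A) (hD : X.Regular n D) (h : ∀ᵐ ω ∂X.μ, ω ∈ X.L n D) :
    X.AlmostClosed n (A ∩ D) := by
  refine ⟨hA.1.inter hD, fun hT => hA.2 ?_⟩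
  rw [Transient, measure_eq_zero_iff_ae_notMem] at hT ⊢
  filter_upwards [hT, h] with ω h1 h2 h3
  rw [mem_U_iff] at h1 h3
  exact h1 (h3.and_eventually (X.mem_L_iff.1 h2))

omit [MeasurableSingletonClass S] [Countable S] in
lemma exists_isBlackwell_of_beta_eq {X : MarkovChain S} {m k : ℕ} (h : X.beta m = k) :
    ∃ 𝒞, X.IsBlackwell m 𝒞 ∧ 𝒞.encard = k := by
  have hne : (Set.encard '' {𝒞 : Set (Set S) | X.IsBlackwell m 𝒞}).Nonempty := by
    by_contra hne
    rw [not_nonempty_iff_eq_empty] at hne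
    rw [beta, hne, sInf_empty] at h
    exact ENat.top_ne_natCast k h
  obtain ⟨𝒞, h𝒞, hcard⟩ := csInf_mem hne
  exact ⟨𝒞, h𝒞, hcard.trans h⟩

lemma beta_ne_of_beta_eq_one {X : MarkovChain S} (hirr : X.Irreducible) (hap : X.Aperiodic)
    {n : ℕ} (hn : 1 ≤ n) {δ : ℝ} (hδ : 0 < δ) (hfin : {i : S | X.Pn n i i < δ}.Finite)
    (hXn : X.beta n = 1) {m : ℕ} (hm : 1 < m) : X.beta m ≠ m := by
  intro hβ
  obtain ⟨𝒟, h𝒟, hcard⟩ := exists_isBlackwell_of_beta_eq (k := 1) hXn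
  obtain ⟨D, rfl⟩ := encard_eq_one.1 hcard
  obtain ⟨𝒞, h𝒞, hcard'⟩ := exists_isBlackwell_of_beta_eq hβ
  have hDL : ∀ᵐ ω ∂X.μ, ω ∈ X.L n D := by
    have h := h𝒟.sum_L_eq_one
    rw [tsum_singleton D fun C => X.μ (X.L n C)] at h
    exact (mem_ae_iff_prob_eq_one (X.measurableSet_L n D)).2 h
  have hDreg := (h𝒟.almostClosed D rfl).1
  obtain ⟨C₁, C₂, hC₁, hC₂, hne⟩ : ∃ a b, a ∈ 𝒞 ∧ b ∈ 𝒞 ∧ a ≠ b := by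
    rw [← one_lt_encard_iff, hcard']
    exact_mod_cast hm
  have hm' : 1 ≤ m := hm.le
  have hAC : ∀ C ∈ 𝒞, X.AlmostClosed n (C ∩ D) := fun C hC =>
    ((h𝒞.almostClosed C hC).transfer hirr hap hn hδ hfin hm').inter_of_ae hDreg hDL
  by_cases hDat : X.Atomic n D
  · exact hDat.2 ⟨C₁ ∩ D, C₂ ∩ D, inter_subset_right, inter_subset_right,
      (h𝒞.disjoint hC₁ hC₂ hne).mono inter_subset_left inter_subset_left,
      hAC C₁ hC₁, hAC C₂ hC₂⟩
  obtain ⟨C, hC, hCat⟩ : ∃ C ∈ 𝒞, X.Atomic m C := by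
    by_contra! h
    exact hne (h𝒞.atMostOneNonatomic _ hC₁ _ hC₂ (h _ hC₁) (h _ hC₂))
  obtain ⟨f, hf, hfd⟩ := exists_pairwise_disjoint_almostClosed
    (h𝒟.nonatomicNoAtomicSubset D rfl hDat) n inter_subset_right (hAC C hC)
  have htransfer := (h𝒞.almostClosed C hC).1.ae_transfer hirr hap hn hδ hfin hm'
  have hhull : ∀ i, ∀ᵐ ω ∂X.μ, ω ∈ X.L m C → ∃ s < n, shiftBy (s * m) ω ∈ X.L n (f i) := by
    intro i
    obtain ⟨T, hT⟩ := (hf i).2.1.exists_hull hirr hap hn hm'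
    have hTreg : X.Regular m T := X.regular_iff.2 (hT.mono fun ω hω hU => hω.2 (hω.1 hU))
    have hCT : ¬ X.Transient m (C ∩ T) := by
      intro hTr
      refine (hf i).2.2 ?_
      rw [Transient, measure_eq_zero_iff_ae_notMem] at hTr ⊢
      filter_upwards [hTr, hT, htransfer, X.regular_iff.1 (hf i).2.1] with ω h1 h2 h3 h4 h5
      have h6 := X.mem_L_iff.1 (h2.2 ⟨0, hn, by rw [zero_mul, shiftBy_zero]; exact h4 h5⟩)
      have h7 := X.mem_L_iff.1 (h3.1 (X.mem_U_iff.2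
        ((X.mem_U_iff.1 h5).mono fun k hk => ((hf i).1 hk).1)))
      exact h1 (X.mem_U_iff.2 (h7.and h6).frequently)
    filter_upwards [hT, hCat.ae_of_subset hTreg hCT] with ω h1 h2 h3
    exact h1.1 (X.L_subset_U _ _ (h2 h3))
  refine hCat.1.2 ?_
  rw [Transient, measure_eq_zero_iff_ae_notMem]
  filter_upwards [ae_all_iff.2 hhull, X.regular_iff.1 hCat.1.1] with ω h1 h2 h3
  choose s hs hsL using fun i => h1 i (h2 h3)
  obtain ⟨i, j, hij, heq⟩ := Fintype.exists_ne_map_eq_of_card_lt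
    (fun i : Fin (n + 1) => (⟨s i, hs i⟩ : Fin n)) (by simp)
  have heq' : s i = s j := congrArg Fin.val heq
  have hi := X.mem_L_iff.1 (hsL i)
  have hj := X.mem_L_iff.1 (hsL j)
  rw [← heq'] at hj
  obtain ⟨k, hki, hkj⟩ := (hi.and hj).exists
  exact Set.disjoint_left.1 (hfd hij) hki hkj

end

end MarkovChain

variable {S : Type} [MeasurableSpace S] [MeasurableSingletonClass S]
  [Countable S] [Infinite S]

/-- If, for some `n ≥ 1`, there is a `δ > 0` with `P^n(i,i) ≥ δ`
for all but finitely many states `i`, and moreover `X^(n)` is simple, then `X`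
is asymptotically aperiodic. -/
theorem stmt13 (X : MarkovChain S) (hirr : X.Irreducible) (hap : X.Aperiodic)
    (hsimple : X.Simple) (n : ℕ) (hn : 1 ≤ n)
    (hδ : ∃ δ : ℝ, 0 < δ ∧ {i : S | X.Pn n i i < δ}.Finite)
    (hXn : X.beta n = 1) :
    X.period = 1 := by
  obtain ⟨δ, hδ, hfin⟩ := hδ
  refine le_antisymm (sSup_le ?_) (le_sSup ⟨1, le_rfl, hsimple, rfl⟩)
  rintro _ ⟨m, hm, hβ, rfl⟩
  obtain rfl | hm := hm.eq_or_lt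
  · exact le_rfl
  · exact absurd hβ (MarkovChain.beta_ne_of_beta_eq_one hirr hap hn hδ hfin hXn hm)
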